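/- arXiv:1305.6957 — 2 statements merged into one kernel-verified Lean document; each statement's English description precedes it below -/
import Mathlib

section
/- For all integers n ≥ 3 and d ≥ 3, the open Waring rank satisfies the recursive inequality Ork(n, d) ≤ Ork(n-1, d) + Ork(n, d-1). -/
open MvPolynomial

noncomputable section WaringSetup

variable {k : Type} [Field k] {n : ℕ}

/-- The linear form `∑ aᵢ xᵢ` with coefficient vector `a`. -/
def linForm (a : Fin n → k) : MvPolynomial (Fin n) k :=
  ∑ i, C (a i) * X i

/-- A subset of the space `S₁` of linear forms (identified with the space of coefficient
vectors) is homogeneous Zariski closed if it is the common zero locus of a set of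
homogeneous polynomial functions. -/
def HomZariskiClosed (V : Set (Fin n → k)) : Prop :=
  ∃ P : Set (MvPolynomial (Fin n) k),
    (∀ p ∈ P, ∃ e : ℕ, p.IsHomogeneous e) ∧
    V = {a | ∀ p ∈ P, eval a p = 0}

/-- `F` can be written as a polynomial in `m` linear forms. -/
def WritableIn (m : ℕ) (F : MvPolynomial (Fin n) k) : Prop :=
  ∃ y : Fin m → MvPolynomial (Fin n) k,
    (∀ j, (y j).IsHomogeneous 1) ∧ ∃ G : MvPolynomial (Fin m) k, F = aeval y G

/-- `F` essentially depends on `n` variables: after any linear change of coordinates it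
cannot be written using fewer than `n` variables. -/
def EssDep (F : MvPolynomial (Fin n) k) : Prop :=
  ∀ m : ℕ, m < n → ¬ WritableIn m F

/-- `OrkV d F V` is the minimal number `m` such that `F` is a sum of `m` `d`-th powers of
linear forms lying outside `V` (and `⊤` if there is no such presentation). -/
def OrkV (d : ℕ) (F : MvPolynomial (Fin n) k) (V : Set (Fin n → k)) : ℕ∞ :=
  sInf ((fun m : ℕ => (m : ℕ∞)) ''
    {m : ℕ | ∃ l : Fin m → (Fin n → k), (∀ i, l i ∉ V) ∧ F = ∑ i, linForm (l i) ^ d})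

/-- The open Waring rank of a form `F`: the supremum of `OrkV d F V` over all homogeneous
Zariski-closed proper subsets `V ⊊ S₁`. -/
def Ork (d : ℕ) (F : MvPolynomial (Fin n) k) : ℕ∞ :=
  ⨆ V : {V : Set (Fin n → k) // HomZariskiClosed V ∧ V ≠ Set.univ}, OrkV d F V.1

/-- The open Waring rank `Ork(n, d)`: the supremum of `Ork F` over all forms `F` of degree
`d` essentially depending on `n` variables. -/
def OrkND (k : Type) [Field k] (n d : ℕ) : ℕ∞ :=
  ⨆ F : {F : MvPolynomial (Fin n) k // F.IsHomogeneous d ∧ EssDep F}, Ork d F.1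

/-- Apply the constant-coefficient differential operator `D` (a polynomial, whose variable
`i` is read as `∂/∂xᵢ`) to the polynomial `F`. -/
def contract (D F : MvPolynomial (Fin n) k) : MvPolynomial (Fin n) k :=
  ∑ s ∈ D.support, D.coeff s •
    ((List.finRange n).foldr (fun i G => (fun H => pderiv i H)^[s i] G) F)

/-- Polynomial functions on the affine space of polynomials: the subalgebra of functions
generated by the coefficient functionals. -/
def PolyFun (n : ℕ) (k : Type) [Field k] : Subalgebra k (MvPolynomial (Fin n) k → k) :=
  Algebra.adjoin k (Set.range fun s : Fin n →₀ ℕ => fun F => coeff s F)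

end WaringSetup

section Helpers

variable {k : Type} [Field k] {n : ℕ}

/-- Directional derivative. -/
noncomputable def dd (γ : Fin n → k) :
    Derivation k (MvPolynomial (Fin n) k) (MvPolynomial (Fin n) k) :=
  mkDerivation k (fun i => C (γ i))

lemma dd_X (γ : Fin n → k) (i : Fin n) : dd γ (X i) = C (γ i) := by
  simp [dd, mkDerivation_X]

lemma dd_C (γ : Fin n → k) (c : k) : dd γ (C c) = 0 := by
  exact derivation_C _ _

lemma dd_add (a b : Fin n → k) (F : MvPolynomial (Fin n) k) : dd (a + b) F = dd a F + dd b F := by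
  have : dd (a + b) = dd a + dd b := by
    apply MvPolynomial.derivation_ext
    intro i
    simp [dd_X]
  rw [this]; rfl

lemma dd_smul (c : k) (b : Fin n → k) (F : MvPolynomial (Fin n) k) :
    dd (c • b) F = c • dd b F := by
  have : dd (c • b) = c • dd b := by
    apply MvPolynomial.derivation_ext
    intro i
    simp [dd_X, smul_eq_C_mul]
  rw [this]; rfl

/-- Directional derivative as a linear map in the direction. -/
noncomputable def ddL (F : MvPolynomial (Fin n) k) :
    (Fin n → k) →ₗ[k] MvPolynomial (Fin n) k where
  toFun γ := dd γ F
  map_add' a b := dd_add a b F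
  map_smul' c b := dd_smul c b F

lemma ddL_apply (F : MvPolynomial (Fin n) k) (γ : Fin n → k) : ddL F γ = dd γ F := rfl

lemma dd_comm (a b : Fin n → k) (F : MvPolynomial (Fin n) k) :
    dd a (dd b F) = dd b (dd a F) := by
  have : ⁅dd a, dd b⁆ = 0 := by
    apply MvPolynomial.derivation_ext
    intro i
    simp [Derivation.commutator_apply, dd_X, dd_C]
  have h := congrArg (fun D => D F) this
  simpa [Derivation.commutator_apply, sub_eq_zero] using h

lemma linForm_add (a b : Fin n → k) : linForm (a + b) = linForm a + linForm b := by
  simp [linForm, add_mul, Finset.sum_add_distrib]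

lemma linForm_smul (c : k) (b : Fin n → k) : linForm (c • b) = C c * linForm b := by
  simp [linForm, Finset.mul_sum, mul_assoc]

/-- linForm as a linear map. -/
noncomputable def linL : (Fin n → k) →ₗ[k] MvPolynomial (Fin n) k where
  toFun := linForm
  map_add' := linForm_add
  map_smul' c b := by simp [linForm_smul, smul_eq_C_mul]

lemma linL_apply (a : Fin n → k) : linL a = linForm a := rfl

lemma linForm_zero : linForm (0 : Fin n → k) = 0 := linL.map_zero

lemma linForm_single (i : Fin n) : linForm (Pi.single i (1 : k)) = X i := by
  simp [linForm, Pi.single_apply]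

lemma linForm_hom (a : Fin n → k) : (linForm a).IsHomogeneous 1 := by
  apply IsHomogeneous.sum
  intro i _
  simpa using (isHomogeneous_C (Fin n) (a i)).mul (isHomogeneous_X k i)

lemma linForm_eval (a b : Fin n → k) : eval b (linForm a) = a ⬝ᵥ b := by
  simp [linForm, dotProduct]

lemma linForm_ne_zero {a : Fin n → k} (h : a ≠ 0) : linForm a ≠ 0 := by
  intro h0
  apply h
  funext i
  have := linForm_eval a (Pi.single i 1)
  rw [h0] at this
  simpa using this.symm

lemma dd_linForm (γ l : Fin n → k) : dd γ (linForm l) = C (γ ⬝ᵥ l) := by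
  simp [linForm, dotProduct, dd_X, dd_C, mul_comm]

lemma dd_linForm_pow (γ l : Fin n → k) (e : ℕ) :
    dd γ (linForm l ^ e) = C ((e : k) * (γ ⬝ᵥ l)) * linForm l ^ (e - 1) := by
  rw [Derivation.leibniz_pow, dd_linForm]
  simp [mul_comm, mul_left_comm]

lemma dd_chain {m : ℕ} (β : Fin n → k) (β' : Fin m → k) (y : Fin m → MvPolynomial (Fin n) k)
    (h : ∀ i, dd β (y i) = C (β' i)) (G : MvPolynomial (Fin m) k) :
    dd β (aeval y G) = aeval y (dd β' G) := by
  induction G using MvPolynomial.induction_on with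
  | C a => simp [algebraMap_eq]
  | add p q hp hq => simp only [map_add, hp, hq]
  | mul_X p i hp =>
    simp only [map_mul, aeval_X, Derivation.leibniz, hp, h, dd_X, smul_eq_mul, map_add,
      aeval_C, algebraMap_eq]

lemma dd_single (i : Fin n) (F : MvPolynomial (Fin n) k) :
    dd (Pi.single i 1) F = pderiv i F := by
  have : dd (Pi.single i (1 : k)) = pderiv i := by
    apply MvPolynomial.derivation_ext
    intro j
    rw [dd_X, pderiv_X]
    by_cases h : j = i
    · subst h; simp
    · simp [Pi.single_apply, h, Ne.symm h]
  rw [this]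

lemma dd_eq_sum (γ : Fin n → k) (F : MvPolynomial (Fin n) k) :
    dd γ F = ∑ i, γ i • pderiv i F := by
  rw [← ddL_apply, LinearMap.pi_apply_eq_sum_univ]
  apply Finset.sum_congr rfl
  intro i _
  rw [ddL_apply, ← dd_single]
  congr 3
  funext j
  simp [Pi.single_apply, eq_comm]

lemma dd_hom {γ : Fin n → k} {F : MvPolynomial (Fin n) k} {e : ℕ} (h : F.IsHomogeneous e) :
    (dd γ F).IsHomogeneous (e - 1) := by
  rw [dd_eq_sum]
  apply IsHomogeneous.sum
  intro i _
  rw [smul_eq_C_mul]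
  simpa using (isHomogeneous_C (Fin n) (γ i)).mul h.pderiv

/-- invariance along directions killing `F` -/
lemma invariance [CharZero k] {κ : Fin n → k} {F : MvPolynomial (Fin n) k} (h : dd κ F = 0)
    (y : Fin n → MvPolynomial (Fin n) k) (T : MvPolynomial (Fin n) k) :
    aeval (fun i => y i + C (κ i) * T) F = aeval y F := by
  let Φ : MvPolynomial (Fin n) k →ₐ[k] Polynomial (MvPolynomial (Fin n) k) :=
    aeval (fun i => Polynomial.C (y i) + Polynomial.C (C (κ i)) * Polynomial.X)
  have hd : ∀ G, Polynomial.derivative (Φ G) = Φ (dd κ G) := by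
    intro G
    induction G using MvPolynomial.induction_on with
    | C a => simp [Φ, dd_C, IsScalarTower.algebraMap_apply k (MvPolynomial (Fin n) k) (Polynomial _)]
    | add p q hp hq => simp [hp, hq]
    | mul_X p i hp =>
      have hX : Φ (X i) = Polynomial.C (y i) + Polynomial.C (C (κ i)) * Polynomial.X := by
        simp [Φ]
      have hC : Φ (C (κ i)) = Polynomial.C (C (κ i)) := by
        simp [Φ, algebraMap_eq]
        try rfl
      rw [Derivation.leibniz, map_mul, Polynomial.derivative_mul, hp, hX, dd_X]
      simp only [map_add, smul_eq_mul, map_mul, hX, hC]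
      simp
      ring
  have h0 : Polynomial.derivative (Φ F) = 0 := by rw [hd, h, map_zero]
  have h1 := Polynomial.derivative_eq_zero.mp h0
  obtain ⟨c, hc⟩ := Polynomial.natDegree_eq_zero.mp h1
  have he : ∀ U : MvPolynomial (Fin n) k,
      Polynomial.eval U (Φ F) = aeval (fun i => y i + C (κ i) * U) F := by
    intro U
    have : ((Polynomial.aeval U).restrictScalars k).comp Φ =
      aeval (fun i => y i + C (κ i) * U) := by
      apply MvPolynomial.algHom_ext
      intro i
      simp [Φ]
    rw [← this]
    simp [Polynomial.coe_aeval_eq_eval]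
  have e1 := he T
  have e0 := he 0
  rw [← hc] at e1 e0
  simp only [Polynomial.eval_C] at e1 e0
  rw [← e1, e0]
  simp

end Helpers

section Helpers2

variable {k : Type} [Field k] {n : ℕ}

lemma dd_zero (F : MvPolynomial (Fin n) k) : dd 0 F = 0 := (ddL F).map_zero

lemma eq_C_of_hom_zero {F : MvPolynomial (Fin n) k} (h : F.IsHomogeneous 0) :
    F = C (coeff 0 F) :=
  totalDegree_eq_zero_iff_eq_C.mp ((totalDegree_zero_iff_isHomogeneous (σ := Fin n) (R := k)).mpr h)

/-- The linear forms killed by `α`. -/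
noncomputable def redL {N : ℕ} (α : Fin (N + 1) → k) (j : Fin (N + 1)) :
    (Fin N → k) →ₗ[k] (Fin (N + 1) → k) where
  toFun l := j.insertNth (-(∑ i, l i * α (j.succAbove i)) / α j) l
  map_add' a b := by
    funext x
    refine Fin.succAboveCases j ?_ ?_ x
    · simp [add_mul, Finset.sum_add_distrib]; ring
    · intro i; simp
  map_smul' c b := by
    funext x
    refine Fin.succAboveCases j ?_ ?_ x
    · simp [mul_assoc, ← Finset.mul_sum]; ring
    · intro i; simp

lemma redL_surj {N : ℕ} (α : Fin (N + 1) → k) (j : Fin (N + 1)) (hj : α j ≠ 0)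
    (a : Fin (N + 1) → k) (h : α ⬝ᵥ a = 0) : redL α j (fun i => a (j.succAbove i)) = a := by
  funext x
  refine Fin.succAboveCases j ?_ ?_ x
  · rw [dotProduct, Fin.sum_univ_succAbove _ j] at h
    simp only [redL, LinearMap.coe_mk, AddHom.coe_mk, Fin.insertNth_apply_same]
    rw [div_eq_iff hj]
    have : ∑ i, a (j.succAbove i) * α (j.succAbove i) =
      ∑ i, α (j.succAbove i) * a (j.succAbove i) := by
      simp only [mul_comm]
    rw [this]
    linear_combination -h
  · intro i; simp [redL]

lemma linForm_insertNth {N : ℕ} (j : Fin (N + 1)) (c : k) (l : Fin N → k) :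
    linForm (j.insertNth c l : Fin (N + 1) → k) =
      C c * X j + ∑ i, C (l i) * X (j.succAbove i) := by
  rw [linForm, Fin.sum_univ_succAbove _ j]
  simp

lemma reduce [CharZero k] {N : ℕ} (α : Fin (N + 1) → k) (j : Fin (N + 1)) (hj : α j ≠ 0)
    {F : MvPolynomial (Fin (N + 1)) k} (h : dd α F = 0) :
    F = aeval (fun i => linForm (redL α j (Pi.single i 1)))
      (aeval (j.insertNth 0 X : Fin (N + 1) → MvPolynomial (Fin N) k) F) := by
  have h1 := invariance h X (C (-(α j)⁻¹) * X j)
  rw [aeval_X_left_apply] at h1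
  have h2 : ((aeval (fun i => linForm (redL α j (Pi.single i 1)))).comp
      (aeval (j.insertNth 0 X : Fin (N + 1) → MvPolynomial (Fin N) k))
        : MvPolynomial (Fin (N + 1)) k →ₐ[k] MvPolynomial (Fin (N + 1)) k) =
      aeval (fun i => X i + C (α i) * (C (-(α j)⁻¹) * X j)) := by
    apply MvPolynomial.algHom_ext
    intro x
    rw [AlgHom.comp_apply, aeval_X, aeval_X]
    refine Fin.succAboveCases j ?_ ?_ x
    · rw [Fin.insertNth_apply_same, map_zero, ← mul_assoc, ← C_mul]
      simp [hj]
    · intro i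
      rw [Fin.insertNth_apply_succAbove, aeval_X]
      simp only [redL, LinearMap.coe_mk, AddHom.coe_mk, linForm_insertNth]
      simp [Pi.single_apply, div_eq_mul_inv]
      ring
  rw [← AlgHom.comp_apply, h2, h1]

lemma essDep_iff [CharZero k] (F : MvPolynomial (Fin n) k) :
    EssDep F ↔ ∀ γ, dd γ F = 0 → γ = 0 := by
  constructor
  · intro h γ hγ
    by_contra hne
    cases n with
    | zero => exact hne (Subsingleton.elim _ _)
    | succ N =>
      obtain ⟨j, hj⟩ := Function.ne_iff.mp hne
      exact h N (Nat.lt_succ_self N) ⟨_, fun i => linForm_hom _, _, reduce γ j hj hγ⟩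
  · rintro h m hm ⟨y, hy, G, rfl⟩
    let T : (Fin n → k) →ₗ[k] (Fin m → k) :=
      LinearMap.pi (fun j => (MvPolynomial.lcoeff k 0) ∘ₗ (ddL (y j)))
    have hT : ¬ Function.Injective T := by
      intro hi
      have := LinearMap.finrank_le_finrank_of_injective hi
      simp at this
      omega
    rw [← LinearMap.ker_eq_bot, Submodule.eq_bot_iff] at hT
    push Not at hT
    obtain ⟨β, hβ, hne⟩ := hT
    apply hne
    apply h
    rw [dd_chain β 0 y]
    · simp [dd_zero]
    · intro i
      rw [eq_C_of_hom_zero (dd_hom (γ := β) (hy i))]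
      have := congrFun hβ i
      simpa [T, ddL_apply] using this

lemma closed_smul {V : Set (Fin n → k)} (hV : HomZariskiClosed V) {l : Fin n → k} (hl : l ∉ V)
    {u : k} (hu : u ≠ 0) : u • l ∉ V := by
  obtain ⟨P, hP, rfl⟩ := hV
  simp only [Set.mem_ofPred_eq, not_forall] at hl ⊢
  obtain ⟨p, hp, hne⟩ := hl
  refine ⟨p, hp, ?_⟩
  obtain ⟨e, he⟩ := hP p hp
  have : eval (u • l) p = u ^ e * eval l p := by
    rw [eval_eq, eval_eq, Finset.mul_sum]
    apply Finset.sum_congr rfl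
    intro s hs
    have := he (mem_support_iff.mp hs)
    rw [← this]
    simp only [Pi.smul_apply, smul_eq_mul, mul_pow, Finset.prod_mul_distrib,
      Finset.prod_pow_eq_pow_sum]
    have h3 : Finsupp.weight (1 : Fin n → ℕ) s = ∑ i ∈ s.support, s i := by
      simp [Finsupp.weight_apply, Finsupp.sum]
    rw [h3]
    ring
  rw [this]
  exact mul_ne_zero (pow_ne_zero _ hu) hne

lemma closed_union {V : Set (Fin n → k)} (hV : HomZariskiClosed V) (γ : Fin n → k) :
    HomZariskiClosed (V ∪ {l | γ ⬝ᵥ l = 0}) := by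
  obtain ⟨P, hP, rfl⟩ := hV
  refine ⟨(fun p => p * linForm γ) '' P, ?_, ?_⟩
  · rintro _ ⟨p, hp, rfl⟩
    obtain ⟨e, he⟩ := hP p hp
    exact ⟨_, he.mul (linForm_hom γ)⟩
  · ext l
    simp only [Set.mem_union, Set.mem_ofPred_eq, Set.forall_mem_image, map_mul, linForm_eval,
      mul_eq_zero]
    by_cases h : γ ⬝ᵥ l = 0 <;> simp [h]

lemma linForm_map {m : ℕ} (ψ : (Fin m → k) →ₗ[k] (Fin n → k)) (l : Fin m → k) :
    aeval (fun i => linForm (ψ (Pi.single i 1))) (linForm l) = linForm (ψ l) := by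
  conv_rhs => rw [← linL_apply, ← LinearMap.comp_apply, LinearMap.pi_apply_eq_sum_univ]
  simp only [linForm, map_sum, map_mul, aeval_C, aeval_X, algebraMap_eq]
  apply Finset.sum_congr rfl
  intro i _
  rw [smul_eq_C_mul]
  congr 1
  have : (fun j => if i = j then (1 : k) else 0) = Pi.single i 1 := by
    funext j; simp [Pi.single_apply, eq_comm]
  rw [this]
  rfl

lemma closed_preimage {m : ℕ} {V : Set (Fin n → k)} (hV : HomZariskiClosed V)
    (ψ : (Fin m → k) →ₗ[k] (Fin n → k)) : HomZariskiClosed (ψ ⁻¹' V) := by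
  obtain ⟨P, hP, rfl⟩ := hV
  let y : Fin n → MvPolynomial (Fin m) k := fun i => linForm (fun j => ψ (Pi.single j 1) i)
  refine ⟨(fun p => aeval y p) '' P, ?_, ?_⟩
  · rintro _ ⟨p, hp, rfl⟩
    obtain ⟨e, he⟩ := hP p hp
    exact ⟨_, he.aeval y (fun i => linForm_hom _)⟩
  · ext l
    simp only [Set.mem_preimage, Set.mem_ofPred_eq, Set.forall_mem_image]
    have : ∀ p, eval l (aeval y p) = eval (ψ l) p := by
      intro p
      have h2 : ((aeval l : MvPolynomial (Fin m) k →ₐ[k] k).comp (aeval y)) = aeval (ψ l) := by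
        apply MvPolynomial.algHom_ext
        intro i
        rw [AlgHom.comp_apply, aeval_X, aeval_X]
        simp only [y]
        change eval l _ = _
        rw [linForm_eval, dotProduct, LinearMap.pi_apply_eq_sum_univ ψ l, Finset.sum_apply]
        apply Finset.sum_congr rfl
        intro j _
        have : (fun j' => if j = j' then (1 : k) else 0) = Pi.single j 1 := by
          funext j; simp [Pi.single_apply, eq_comm]
        rw [this, Pi.smul_apply, smul_eq_mul, mul_comm]
      exact congrArg (fun f => f p) h2
    simp only [this]

lemma OrkV_le {ι : Type} [Fintype ι] (d : ℕ) (F : MvPolynomial (Fin n) k) (V : Set (Fin n → k))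
    (l : ι → Fin n → k) (hl : ∀ i, l i ∉ V) (hF : F = ∑ i, linForm (l i) ^ d) :
    OrkV d F V ≤ (Fintype.card ι : ℕ∞) := by
  apply sInf_le
  refine ⟨Fintype.card ι, ⟨fun i => l ((Fintype.equivFin ι).symm i), fun i => hl _, ?_⟩, rfl⟩
  rw [hF]
  exact (Equiv.sum_comp (Fintype.equivFin ι).symm (fun i => linForm (l i) ^ d)).symm

lemma OrkV_exists {d : ℕ} {F : MvPolynomial (Fin n) k} {V : Set (Fin n → k)}
    (h : OrkV d F V ≠ ⊤) : ∃ (m : ℕ) (l : Fin m → Fin n → k), (m : ℕ∞) = OrkV d F V ∧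
      (∀ i, l i ∉ V) ∧ F = ∑ i, linForm (l i) ^ d := by
  unfold OrkV at h
  have hne : ((fun m : ℕ => (m : ℕ∞)) ''
    {m : ℕ | ∃ l : Fin m → (Fin n → k), (∀ i, l i ∉ V) ∧ F = ∑ i, linForm (l i) ^ d}).Nonempty := by
    by_contra hc
    rw [Set.not_nonempty_iff_eq_empty] at hc
    rw [hc] at h
    simp at h
  obtain ⟨m, ⟨l, h1, h2⟩, h3⟩ := csInf_mem hne
  exact ⟨m, l, h3, h1, h2⟩

/-- Transport of presentations along a linear map. -/
lemma OrkV_transport {m d : ℕ} (ψ : (Fin m → k) →ₗ[k] (Fin n → k)) {H : MvPolynomial (Fin m) k}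
    (hH : H.IsHomogeneous d) (hE : EssDep H) {V : Set (Fin n → k)} (hV : HomZariskiClosed V)
    (l : Fin m → k) (hl : ψ l ∉ V) :
    OrkV d (aeval (fun i => linForm (ψ (Pi.single i 1))) H) V ≤ OrkND k m d := by
  have hp : ψ ⁻¹' V ≠ Set.univ := fun h => hl (by
    have : l ∈ ψ ⁻¹' V := h ▸ Set.mem_univ l
    exact this)
  have h1 : OrkV d H (ψ ⁻¹' V) ≤ OrkND k m d := by
    refine le_trans ?_ (le_iSup (fun F : {F : MvPolynomial (Fin m) k // F.IsHomogeneous d ∧ EssDep F}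
      => Ork d F.1) ⟨H, hH, hE⟩)
    exact le_iSup (fun V : {V : Set (Fin m → k) // HomZariskiClosed V ∧ V ≠ Set.univ}
      => OrkV d H V.1) ⟨ψ ⁻¹' V, closed_preimage hV ψ, hp⟩
  refine le_trans ?_ h1
  by_cases ht : OrkV d H (ψ ⁻¹' V) = ⊤
  · rw [ht]; exact le_top
  obtain ⟨r, l, hr, h2, h3⟩ := OrkV_exists ht
  rw [← hr]
  have := OrkV_le d (aeval (fun i => linForm (ψ (Pi.single i 1))) H) V (fun i => ψ (l i)) h2 (by
    conv_lhs => rw [h3]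
    simp only [map_sum, map_pow, linForm_map])
  simpa using this

end Helpers2

section Helpers3

variable {k : Type} [Field k] {n : ℕ}

lemma invariance_sum [CharZero k] {ι : Type} {κ : ι → Fin n → k} {F : MvPolynomial (Fin n) k}
    (h : ∀ j, dd (κ j) F = 0) (T : ι → MvPolynomial (Fin n) k) (S : Finset ι) :
    aeval (fun i => X i + ∑ j ∈ S, C (κ j i) * T j) F = F := by
  classical
  induction S using Finset.induction_on with
  | empty => simp
  | insert j S hj ih =>
    conv_rhs => rw [← ih]
    rw [← invariance (h j) (fun i => X i + ∑ j ∈ S, C (κ j i) * T j) (T j)]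
    congr 2
    funext i
    rw [Finset.sum_insert hj]
    ring

/-- dot product as a functional -/
def dotL (κ : Fin n → k) : (Fin n → k) →ₗ[k] k where
  toFun l := κ ⬝ᵥ l
  map_add' a b := dotProduct_add κ a b
  map_smul' c b := by simp

lemma core [CharZero k] {f : MvPolynomial (Fin n) k} {e : ℕ} (he : 2 ≤ e) (hf : f.IsHomogeneous e)
    {V : Set (Fin n → k)} (hV : HomZariskiClosed V) {s : ℕ} (κ y : Fin s → Fin n → k)
    (hκ : ∀ i, dd (κ i) f = 0) (hy : ∀ i j, κ i ⬝ᵥ y j = if i = j then 1 else 0)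
    (hβ : ∀ β, dd β f = 0 → (∀ j, β ⬝ᵥ y j = 0) → β = 0)
    (c : Fin s → k) (m : Fin n → k) (hc : ∑ j, c j ^ e = 0)
    (l : Fin n → k) (hl : l + ∑ j, (κ j ⬝ᵥ l) • (-y j + c j • m) ∉ V) :
    OrkV e f V ≤ OrkND k n e := by
  let ψ : (Fin n → k) →ₗ[k] (Fin n → k) :=
    LinearMap.id + ∑ j, (dotL (κ j)).smulRight (-y j + c j • m)
  have hψ : ∀ l, ψ l = l + ∑ j, (κ j ⬝ᵥ l) • (-y j + c j • m) := by
    intro l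
    simp [ψ, dotL]
  let H := f + ∑ j, linForm (y j) ^ e
  have hH : H.IsHomogeneous e := by
    apply IsHomogeneous.add hf
    apply IsHomogeneous.sum
    intro j _
    simpa using (linForm_hom (y j)).pow e
  have he0 : (e : k) ≠ 0 := by
    rw [Nat.cast_ne_zero]; omega
  have he1 : ((e - 1 : ℕ) : k) ≠ 0 := by
    rw [Nat.cast_ne_zero]; omega
  have hE : EssDep H := by
    rw [essDep_iff]
    intro β hb
    have hb1 : dd β f + ∑ j, C ((e : k) * (β ⬝ᵥ y j)) * linForm (y j) ^ (e - 1) = 0 := by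
      rw [← hb]
      simp only [H, map_add, map_sum, dd_linForm_pow]
    have hz : ∀ i, β ⬝ᵥ y i = 0 := by
      intro i
      have h2 := congrArg (dd (κ i)) hb1
      rw [map_add, dd_comm, hκ, map_zero, zero_add, map_sum, map_zero,
        Finset.sum_eq_single i] at h2
      · rw [← smul_eq_C_mul, Derivation.map_smul, dd_linForm_pow, hy, smul_eq_C_mul] at h2
        have hyi : y i ≠ 0 := by
          intro h0
          have := hy i i
          rw [h0] at this
          simp at this
        have h3 : linForm (y i) ^ (e - 1 - 1) ≠ 0 := pow_ne_zero _ (linForm_ne_zero hyi)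
        rw [← mul_assoc, mul_eq_zero, or_iff_left h3, ← C_mul, C_eq_zero] at h2
        simpa [he0, he1] using h2
      · intro j _ hji
        rw [← smul_eq_C_mul, Derivation.map_smul, dd_linForm_pow, hy, if_neg (Ne.symm hji)]
        simp
      · simp
    apply hβ β _ hz
    simpa [hz] using hb1
  have hfin : aeval (fun i => linForm (ψ (Pi.single i 1))) H = f := by
    have h1 : ∀ j, ψ (y j) = c j • m := by
      intro j
      rw [hψ]
      simp only [hy, ite_smul, one_smul, zero_smul, Finset.sum_ite_eq', Finset.mem_univ, if_true]
      abel
    have h2 : aeval (fun i => linForm (ψ (Pi.single i 1))) f = f := by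
      conv_rhs => rw [← invariance_sum hκ (fun j => linForm (-y j + c j • m)) Finset.univ]
      congr 2
      funext i
      rw [hψ, linForm_add, linForm_single, ← linL_apply, map_sum]
      simp only [linL_apply, linForm_smul, dotProduct_single, mul_one]
    simp only [H, map_add, map_sum, map_pow, linForm_map, h1, h2, linForm_smul, mul_pow]
    rw [← Finset.sum_mul]
    simp only [← C_pow]
    rw [← map_sum, hc]
    simp
  rw [← hfin]
  exact OrkV_transport ψ hH hE hV l (by rw [hψ]; exact hl)

lemma dual_basis {s : ℕ} (K : Submodule k (Fin n → k)) (hs : Module.finrank k K = s) :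
    ∃ κ y : Fin s → Fin n → k, (∀ i, κ i ∈ K) ∧
      (∀ i j, κ i ⬝ᵥ y j = if i = j then 1 else 0) ∧
      (∀ β ∈ K, (∀ j, β ⬝ᵥ y j = 0) → β = 0) := by
  let b := Module.finBasisOfFinrankEq k K hs
  have h1 : ∀ j, ∃ w : Fin n → k, ∀ x : K, (x : Fin n → k) ⬝ᵥ w = b.repr x j := by
    intro j
    obtain ⟨g, hg⟩ := LinearMap.exists_extend (b.coord j)
    refine ⟨fun i => g (Pi.single i 1), fun x => ?_⟩
    have h2 : g (x : Fin n → k) = b.coord j x := by rw [← hg]; rfl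
    rw [← Module.Basis.coord_apply, ← h2, LinearMap.pi_apply_eq_sum_univ g, dotProduct]
    apply Finset.sum_congr rfl
    intro i _
    have : (fun j => if i = j then (1 : k) else 0) = Pi.single i 1 := by
      funext j; simp [Pi.single_apply, eq_comm]
    rw [this, smul_eq_mul]
  choose y hy using h1
  refine ⟨fun i => b i, y, fun i => (b i).2, ?_, ?_⟩
  · intro i j
    rw [hy]
    simp [Finsupp.single_apply]
  · intro β hβ h
    have : (⟨β, hβ⟩ : K) = 0 := by
      apply b.repr.injective
      ext j
      rw [← hy]
      simpa using h j
    exact congrArg Subtype.val this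

lemma ork_bound [CharZero k] [IsAlgClosed k] {f : MvPolynomial (Fin n) k} {e : ℕ} (he : 2 ≤ e)
    (hf : f.IsHomogeneous e) {V : Set (Fin n → k)} (hV : HomZariskiClosed V)
    {a : Fin n → k} (ha : a ∉ V)
    (h : (∃ l, l ∉ V ∧ ∀ κ, dd κ f = 0 → κ ⬝ᵥ l = 0) ∨
      2 ≤ Module.finrank k (LinearMap.ker (ddL f))) :
    OrkV e f V ≤ OrkND k n e := by
  rcases h with ⟨l, hl, hk⟩ | h
  · obtain ⟨κ, y, h1, h2, h3⟩ := dual_basis (LinearMap.ker (ddL f)) rfl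
    refine core he hf hV κ y h1 h2 h3 (fun _ => 0) 0 ?_ l ?_
    · rw [zero_pow (by omega)]; simp
    · simpa [fun j => hk _ (h1 j)] using hl
  · obtain ⟨s, hs⟩ := Nat.exists_eq_add_of_le' h
    obtain ⟨κ, y, h1, h2, h3⟩ := dual_basis (LinearMap.ker (ddL f)) hs
    obtain ⟨ζ, hζ⟩ := IsAlgClosed.exists_pow_nat_eq (-1 : k) (n := e) (by omega)
    have he0 : e ≠ 0 := by omega
    refine core he hf hV κ y h1 h2 h3 (Fin.cons 1 (Fin.cons ζ fun _ => 0)) a ?_ (y 0) ?_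
    · simp [Fin.sum_univ_succ, hζ, he0]
    · simp only [h2, ite_smul, one_smul, zero_smul, Finset.sum_ite_eq', Finset.mem_univ, if_true,
        Fin.cons_zero]
      rwa [add_neg_cancel_left]

lemma line_poly (p : MvPolynomial (Fin n) k) (a b : Fin n → k) :
    ∃ q : Polynomial k, ∀ t, q.eval t = eval (a + t • b) p := by
  refine ⟨aeval (fun i => Polynomial.C (a i) + Polynomial.C (b i) * Polynomial.X) p, fun t => ?_⟩
  have : (Polynomial.aeval t).comp
      (aeval (fun i => Polynomial.C (a i) + Polynomial.C (b i) * Polynomial.X)) =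
      (aeval (a + t • b) : MvPolynomial (Fin n) k →ₐ[k] k) := by
    apply MvPolynomial.algHom_ext
    intro i
    rw [AlgHom.comp_apply, aeval_X, aeval_X]
    simp only [map_add, map_mul, Polynomial.aeval_C, Polynomial.aeval_X, Algebra.algebraMap_self,
      RingHom.id_apply, Pi.add_apply, Pi.smul_apply, smul_eq_mul]
    ring
  have h := congrArg (fun f => f p) this
  simpa [Polynomial.coe_aeval_eq_eval] using h

lemma avoid [CharZero k] {V : Set (Fin n → k)} (hV : HomZariskiClosed V) {a b γ : Fin n → k}
    (ha : a ∉ V) (hb : γ ⬝ᵥ b ≠ 0) : ∃ t : k, a + t • b ∉ V ∧ γ ⬝ᵥ (a + t • b) ≠ 0 := by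
  obtain ⟨P, hP, rfl⟩ := hV
  simp only [Set.mem_ofPred_eq, not_forall] at ha ⊢
  obtain ⟨p, hp, hne⟩ := ha
  obtain ⟨q, hq⟩ := line_poly p a b
  have hq0 : q ≠ 0 := by
    rintro rfl
    have := hq 0
    simp at this
    exact hne this.symm
  let r : Polynomial k := Polynomial.C (γ ⬝ᵥ a) + Polynomial.C (γ ⬝ᵥ b) * Polynomial.X
  have hr : ∀ t, r.eval t = γ ⬝ᵥ (a + t • b) := by
    intro t
    simp only [r, dotProduct_add, dotProduct_smul, Polynomial.eval_add, Polynomial.eval_mul,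
      Polynomial.eval_C, Polynomial.eval_X, smul_eq_mul]
    ring
  have hr0 : r ≠ 0 := by
    intro h
    have := congrArg (fun p => p.coeff 1) h
    simp [r, Polynomial.coeff_C] at this
    exact hb this
  have : ∃ t, (q * r).eval t ≠ 0 := by
    by_contra hc
    push Not at hc
    exact mul_ne_zero hq0 hr0 (Polynomial.funext (by simpa using hc))
  obtain ⟨t, ht⟩ := this
  rw [Polynomial.eval_mul, hq, hr] at ht
  exact ⟨t, ⟨p, hp, left_ne_zero_of_mul ht⟩, right_ne_zero_of_mul ht⟩

lemma finite_hyper {V : Set (Fin n → k)} (hV : HomZariskiClosed V) {a : Fin n → k}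
    (ha : a ∉ V) : {κ : Fin n → k | κ ⬝ᵥ a = 1 ∧ ∀ l, κ ⬝ᵥ l = 0 → l ∈ V}.Finite := by
  classical
  obtain ⟨P, hP, rfl⟩ := hV
  simp only [Set.mem_ofPred_eq, not_forall] at ha ⊢
  obtain ⟨p, hp, hne⟩ := ha
  choose q hq using fun j : Fin n => line_poly p a (Pi.single j 1)
  have hq0 : ∀ j, q j ≠ 0 := by
    intro j h0
    have := hq j 0
    rw [h0] at this
    simp at this
    exact hne this.symm
  apply (Set.Finite.pi (fun j : Fin n =>
    (insert 0 ((q j).roots.toFinset.image (fun t => -t⁻¹))).finite_toSet)).subset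
  rintro κ ⟨h1, h2⟩ j -
  simp only [Finset.coe_insert, Set.mem_insert_iff, Finset.mem_coe, Finset.mem_image,
    Multiset.mem_toFinset, Polynomial.mem_roots (hq0 j)]
  by_cases hk : κ j = 0
  · exact Or.inl hk
  · right
    refine ⟨-(κ j)⁻¹, ?_, by simp⟩
    rw [Polynomial.IsRoot, hq]
    refine h2 _ ?_ p hp
    simp [dotProduct_add, h1, hk]

lemma lin_poly (g : (Fin n → k) →ₗ[k] k) :
    ∃ p : MvPolynomial (Fin n) k, ∀ γ, eval γ p = g γ := by
  refine ⟨linForm (fun i => g (Pi.single i 1)), fun γ => ?_⟩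
  rw [linForm_eval, LinearMap.pi_apply_eq_sum_univ g, dotProduct]
  apply Finset.sum_congr rfl
  intro i _
  have : (fun j => if i = j then (1 : k) else 0) = Pi.single i 1 := by
    funext j; simp [Pi.single_apply, eq_comm]
  rw [this, smul_eq_mul, mul_comm]

end Helpers3

section Helpers4

variable {k : Type} [Field k] {n : ℕ}

lemma exists_sq [CharZero k] {F : MvPolynomial (Fin n) k} {d : ℕ} (hd : 2 ≤ d) (hn : 0 < n)
    (hF : F.IsHomogeneous d) (hE : EssDep F) : ∃ b, dd b (dd b F) ≠ 0 := by
  by_contra hc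
  push Not at hc
  have hab : ∀ a b, dd a (dd b F) = 0 := by
    intro a b
    have h := hc (a + b)
    rw [dd_add, dd_add, map_add, map_add, hc, hc, dd_comm b a] at h
    have h2 : (2 : k) • dd a (dd b F) = 0 := by
      rw [two_smul]
      simpa using h
    exact (smul_eq_zero.mp h2).resolve_left two_ne_zero
  rw [essDep_iff] at hE
  have hb := hE (Pi.single ⟨0, hn⟩ 1) (by
    have hg := (dd_hom (γ := Pi.single ⟨0, hn⟩ 1) hF).sum_X_mul_pderiv
    have hz : ∀ i, pderiv i (dd (Pi.single ⟨0, hn⟩ 1) F) = 0 := by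
      intro i
      rw [← dd_single]
      exact hab _ _
    simp only [hz, mul_zero, Finset.sum_const_zero] at hg
    have h3 := hg.symm
    rw [smul_eq_zero] at h3
    exact h3.resolve_left (by omega))
  have := congrFun hb ⟨0, hn⟩
  simp at this

lemma exists_dir [CharZero k] {F : MvPolynomial (Fin n) k} {d : ℕ} (hd : 2 ≤ d) (hn : 2 ≤ n)
    (hF : F.IsHomogeneous d) (hE : EssDep F) {V : Set (Fin n → k)} (hV : HomZariskiClosed V)
    {a : Fin n → k} (ha : a ∉ V) :
    ∃ γ, dd γ (dd γ F) ≠ 0 ∧ (∃ l, γ ⬝ᵥ l = 0 ∧ l ∉ V) ∧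
      ∀ κ, κ ≠ 0 → dd κ (dd γ F) = 0 → ∃ l, κ ⬝ᵥ l = 0 ∧ l ∉ V := by
  classical
  obtain ⟨b, hb⟩ := exists_sq hd (by omega) hF hE
  have hE' := (essDep_iff F).mp hE
  let K := (finite_hyper hV ha).toFinset
  have hKm : ∀ κ, κ ∈ K ↔ κ ⬝ᵥ a = 1 ∧ ∀ l, κ ⬝ᵥ l = 0 → l ∈ V := by
    intro κ; simp [K]
  -- the quadratic condition
  have hQ : ∃ q : MvPolynomial (Fin n) k, q ≠ 0 ∧ ∀ γ, eval γ q ≠ 0 → dd γ (dd γ F) ≠ 0 := by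
    obtain ⟨s, hs⟩ := ne_zero_iff.mp hb
    choose p hp using fun i : Fin n =>
      lin_poly ((MvPolynomial.lcoeff k s) ∘ₗ (ddL (pderiv i F)))
    have hev : ∀ γ, eval γ (∑ i, X i * p i) = coeff s (dd γ (dd γ F)) := by
      intro γ
      rw [dd_eq_sum γ F, map_sum, map_sum, coeff_sum]
      apply Finset.sum_congr rfl
      intro i _
      rw [map_mul, eval_X, hp, Derivation.map_smul, coeff_smul, smul_eq_mul]
      rfl
    refine ⟨∑ i, X i * p i, ?_, ?_⟩
    · intro h0
      have := hev b
      rw [h0, map_zero] at this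
      exact hs this.symm
    · intro γ h1 h2
      rw [hev, h2] at h1
      simp at h1
  have hL : ∀ κ : Fin n → k, ∃ q : MvPolynomial (Fin n) k, κ ∈ K → q ≠ 0 ∧
      ∀ γ, eval γ q ≠ 0 → dd γ (dd κ F) ≠ 0 := by
    intro κ
    by_cases hk : κ ∈ K
    swap
    · exact ⟨0, fun h => absurd h hk⟩
    have hk0 : κ ≠ 0 := by
      rintro rfl
      have := ((hKm _).mp hk).1
      simp at this
    have hkF : dd κ F ≠ 0 := fun h => hk0 (hE' κ h)
    have : ∃ c, dd c (dd κ F) ≠ 0 := by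
      by_contra hc
      push Not at hc
      have hg := (dd_hom (γ := κ) hF).sum_X_mul_pderiv
      simp only [← dd_single, hc, mul_zero, Finset.sum_const_zero] at hg
      have h3 := hg.symm
      rw [smul_eq_zero] at h3
      exact hkF (h3.resolve_left (by omega))
    obtain ⟨c, hc⟩ := this
    obtain ⟨s, hs⟩ := ne_zero_iff.mp hc
    obtain ⟨p, hp⟩ := lin_poly ((MvPolynomial.lcoeff k s) ∘ₗ (ddL (dd κ F)))
    refine ⟨p, fun _ => ⟨?_, ?_⟩⟩
    · rintro rfl
      have := hp c
      rw [map_zero] at this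
      exact hs this.symm
    · intro γ h1 h2
      rw [hp] at h1
      apply h1
      rw [LinearMap.comp_apply, ddL_apply, h2, map_zero]
  have hM : ∀ κ : Fin n → k, ∃ q : MvPolynomial (Fin n) k, κ ∈ K → q ≠ 0 ∧
      ∀ c : k, eval (c • κ) q = 0 := by
    intro κ
    by_cases hk : κ ∈ K
    swap
    · exact ⟨0, fun h => absurd h hk⟩
    have hk0 : κ ≠ 0 := by
      rintro rfl
      have := ((hKm _).mp hk).1
      simp at this
    obtain ⟨i, hi⟩ := Function.ne_iff.mp hk0
    haveI : Nontrivial (Fin n) := Fin.nontrivial_iff_two_le.mpr hn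
    obtain ⟨i', hi'⟩ := exists_ne i
    refine ⟨C (κ i) * X i' - C (κ i') * X i, fun _ => ⟨?_, ?_⟩⟩
    · intro h0
      have := congrArg (eval (Pi.single i' (1 : k))) h0
      simp [Pi.single_apply, hi'.symm] at this
      exact hi this
    · intro c
      simp
      ring
  obtain ⟨Q, hQ0, hQ1⟩ := hQ
  choose L hL using hL
  choose M hM using hM
  have hprod : Q * ∏ κ ∈ K, (L κ * M κ) ≠ 0 := by
    apply mul_ne_zero hQ0
    rw [Finset.prod_ne_zero_iff]
    intro κ hk
    exact mul_ne_zero (hL κ hk).1 (hM κ hk).1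
  have : ∃ γ, eval γ (Q * ∏ κ ∈ K, (L κ * M κ)) ≠ 0 := by
    by_contra hc
    push Not at hc
    exact hprod (MvPolynomial.funext (by simpa using hc))
  obtain ⟨γ, hγ⟩ := this
  rw [map_mul, map_prod] at hγ
  have g1 := left_ne_zero_of_mul hγ
  have g2 := Finset.prod_ne_zero_iff.mp (right_ne_zero_of_mul hγ)
  -- normalisation
  have hnorm : ∀ κ : Fin n → k, (∀ l, κ ⬝ᵥ l = 0 → l ∈ V) →
      κ ⬝ᵥ a ≠ 0 ∧ (κ ⬝ᵥ a)⁻¹ • κ ∈ K := by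
    intro κ h
    have h0 : κ ⬝ᵥ a ≠ 0 := fun h1 => ha (h a h1)
    refine ⟨h0, (hKm _).mpr ⟨by simp [h0], fun l hl => h l ?_⟩⟩
    simpa [h0] using hl
  refine ⟨γ, hQ1 γ g1, ?_, ?_⟩
  · by_contra hc
    push Not at hc
    obtain ⟨h0, h1⟩ := hnorm γ hc
    have h2 := g2 _ h1
    rw [map_mul] at h2
    apply right_ne_zero_of_mul h2
    have h3 := (hM _ h1).2 (γ ⬝ᵥ a)
    rwa [smul_smul, mul_inv_cancel₀ h0, one_smul] at h3
  · intro κ hk hz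
    by_contra hc
    push Not at hc
    obtain ⟨h0, h1⟩ := hnorm κ hc
    have h2 := g2 _ h1
    rw [map_mul] at h2
    apply (hL _ h1).2 γ (left_ne_zero_of_mul h2)
    rw [dd_smul, Derivation.map_smul, dd_comm, hz, smul_zero]

lemma exists_good [CharZero k] [IsAlgClosed k] {F : MvPolynomial (Fin n) k} {d : ℕ} (hd : 3 ≤ d)
    (hn : 2 ≤ n)
    (hF : F.IsHomogeneous d) (hE : EssDep F) {V : Set (Fin n → k)} (hV : HomZariskiClosed V)
    {a : Fin n → k} (ha : a ∉ V) :
    ∃ γ, γ ≠ 0 ∧ (∃ l, γ ⬝ᵥ l = 0 ∧ l ∉ V) ∧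
      OrkV (d - 1) (dd γ F) (V ∪ {l | γ ⬝ᵥ l = 0}) ≤ OrkND k n (d - 1) := by
  obtain ⟨γ, h1, h2, h3⟩ := exists_dir (by omega) hn hF hE hV ha
  have hγ : γ ≠ 0 := by
    rintro rfl
    simp [dd_zero] at h1
  have hne : ∀ κ : Fin n → k, κ ≠ 0 → ∃ b, κ ⬝ᵥ b ≠ 0 := by
    intro κ hk
    obtain ⟨i, hi⟩ := Function.ne_iff.mp hk
    exact ⟨Pi.single i 1, by simpa using hi⟩
  obtain ⟨b, hb⟩ := hne γ hγ
  have hnot : ∀ l, l ∉ V → γ ⬝ᵥ l ≠ 0 → l ∉ V ∪ {l | γ ⬝ᵥ l = 0} := by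
    rintro l ha hb (h | h)
    · exact ha h
    · exact hb h
  obtain ⟨t, ht1, ht2⟩ := avoid hV ha hb
  refine ⟨γ, hγ, h2, ork_bound (by omega) (dd_hom hF) (closed_union hV γ) (hnot _ ht1 ht2) ?_⟩
  by_cases hr : 2 ≤ Module.finrank k (LinearMap.ker (ddL (dd γ F)))
  · exact Or.inr hr
  left
  obtain ⟨⟨κ, hκ⟩, hv⟩ := finrank_le_one_iff.mp (show
    Module.finrank k (LinearMap.ker (ddL (dd γ F))) ≤ 1 by omega)
  have hκ' : dd κ (dd γ F) = 0 := hκ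
  have hl1 : ∃ l, κ ⬝ᵥ l = 0 ∧ l ∉ V := by
    by_cases hk0 : κ = 0
    · exact ⟨a, by simp [hk0], ha⟩
    · exact h3 κ hk0 hκ'
  have hl2 : ∃ l, κ ⬝ᵥ l = 0 ∧ γ ⬝ᵥ l ≠ 0 := by
    by_cases hk0 : κ = 0
    · exact ⟨b, by simp [hk0], hb⟩
    · obtain ⟨c, hc⟩ := hne κ hk0
      by_contra hcon
      push Not at hcon
      have key : γ = ((γ ⬝ᵥ c) / (κ ⬝ᵥ c)) • κ := by
        funext i
        have h := hcon (Pi.single i 1 - (κ i / (κ ⬝ᵥ c)) • c) (by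
          rw [dotProduct_sub, dotProduct_smul, dotProduct_single, smul_eq_mul]
          field_simp
          ring)
        rw [dotProduct_sub, dotProduct_smul, dotProduct_single, smul_eq_mul] at h
        rw [Pi.smul_apply, smul_eq_mul]
        linear_combination h
      apply h1
      have : dd γ (dd γ F) = ((γ ⬝ᵥ c) / (κ ⬝ᵥ c)) • dd κ (dd γ F) := by
        rw [← dd_smul, ← key]
      rw [this, hκ', smul_zero]
  obtain ⟨l1, hl1, hl1'⟩ := hl1
  obtain ⟨l2, hl2, hl2'⟩ := hl2
  obtain ⟨u, hu1, hu2⟩ := avoid hV hl1' hl2'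
  refine ⟨l1 + u • l2, hnot _ hu1 hu2, ?_⟩
  intro κ1 hκ1
  obtain ⟨c, hc⟩ := hv ⟨κ1, hκ1⟩
  have hc' : c • κ = κ1 := congrArg Subtype.val hc
  rw [← hc', smul_dotProduct, dotProduct_add, dotProduct_smul, hl1, hl2]
  simp

/-- Presentations adapted to a direction. -/
def Adapted (d : ℕ) (F : MvPolynomial (Fin n) k) (V : Set (Fin n → k)) (m : ℕ) : Prop :=
  ∃ (γ : Fin n → k) (ι : Type) (_ : Fintype ι) (l : ι → Fin n → k), Fintype.card ι = m ∧ γ ≠ 0 ∧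
    (∃ a, γ ⬝ᵥ a = 0 ∧ a ∉ V) ∧ (∀ i, l i ∉ V ∧ γ ⬝ᵥ l i ≠ 0) ∧
    dd γ F = ∑ i, linForm (l i) ^ (d - 1)

lemma scale_pow [IsAlgClosed k] {V : Set (Fin n → k)} (hV : HomZariskiClosed V) {e : ℕ}
    (he : 0 < e) {c : k} (hc : c ≠ 0) (l : Fin n → k) :
    ∃ u : k, u ≠ 0 ∧ C c * linForm l ^ e = linForm (u • l) ^ e := by
  obtain ⟨u, hu⟩ := IsAlgClosed.exists_pow_nat_eq c he
  refine ⟨u, ?_, ?_⟩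
  · rintro rfl
    rw [zero_pow he.ne'] at hu
    exact hc hu.symm
  · rw [linForm_smul, mul_pow, ← C_pow, hu]

lemma main_bound [CharZero k] [IsAlgClosed k] {N d : ℕ} (hd : 3 ≤ d) (hn : 1 ≤ N)
    {F : MvPolynomial (Fin (N + 1)) k}
    (hF : F.IsHomogeneous d) (hE : EssDep F) {V : Set (Fin (N + 1) → k)} (hV : HomZariskiClosed V)
    {a : Fin (N + 1) → k} (ha : a ∉ V) :
    OrkV d F V ≤ OrkND k N d + OrkND k (N + 1) (d - 1) := by
  classical
  by_cases htop : OrkND k (N + 1) (d - 1) = ⊤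
  · rw [htop]; simp
  have hE' := (essDep_iff F).mp hE
  have hex : ∃ m, Adapted d F V m ∧ (m : ℕ∞) ≤ OrkND k (N + 1) (d - 1) := by
    obtain ⟨γ, hγ, h2, h3⟩ := exists_good hd (by omega) hF hE hV ha
    obtain ⟨m, l, hm, hl, hs⟩ := OrkV_exists (ne_top_of_le_ne_top htop h3)
    refine ⟨m, ⟨γ, Fin m, inferInstance, l, by simp, hγ, h2, ?_, hs⟩, hm ▸ h3⟩
    intro i
    have := hl i
    simp only [Set.mem_union, not_or] at this
    exact this
  have hex' : ∃ m, Adapted d F V m := ⟨_, hex.choose_spec.1⟩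
  have hmin : ∀ r, r < Nat.find hex' → ¬ Adapted d F V r := fun r hr => Nat.find_min hex' hr
  have hle : (Nat.find hex' : ℕ∞) ≤ OrkND k (N + 1) (d - 1) := by
    obtain ⟨m, h1, h2⟩ := hex
    refine le_trans ?_ h2
    exact_mod_cast Nat.find_min' hex' h1
  obtain ⟨α, ι, hι, l, hcard, hα, ⟨a', ha0, haV⟩, hl, hsum⟩ := Nat.find_spec hex'
  rw [← hcard] at hmin hle
  have hd0 : (d : k) ≠ 0 := by
    rw [Nat.cast_ne_zero]; omega
  let c : ι → k := fun i => ((d : k) * (α ⬝ᵥ l i))⁻¹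
  have hc : ∀ i, c i ≠ 0 := fun i => inv_ne_zero (mul_ne_zero hd0 (hl i).2)
  let G := F - ∑ i, C (c i) * linForm (l i) ^ d
  have hddG : ∀ β, dd β G = dd β F -
      ∑ i, C ((β ⬝ᵥ l i) / (α ⬝ᵥ l i)) * linForm (l i) ^ (d - 1) := by
    intro β
    simp only [G, map_sub, map_sum]
    congr 1
    apply Finset.sum_congr rfl
    intro i _
    rw [← smul_eq_C_mul, Derivation.map_smul, dd_linForm_pow, smul_eq_C_mul, ← mul_assoc, ← C_mul]
    congr 2
    have := (hl i).2
    simp only [c]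
    field_simp
  have hG0 : dd α G = 0 := by
    rw [hddG, hsum, sub_eq_zero]
    apply Finset.sum_congr rfl
    intro i _
    rw [div_self (hl i).2, C_1, one_mul]
  have hGh : G.IsHomogeneous d := by
    apply IsHomogeneous.sub hF
    apply IsHomogeneous.sum
    intro i _
    simpa using (isHomogeneous_C _ (c i)).mul ((linForm_hom (l i)).pow d)
  have hι : Nonempty ι := by
    by_contra hc
    rw [not_nonempty_iff] at hc
    apply hα
    apply hE'
    rw [hsum]
    simp
  -- the kernel of `G` is spanned by `α`
  have hker : ∀ β, dd β G = 0 → ∃ t : k, β = t • α := by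
    intro β hβ
    obtain ⟨i0⟩ := hι
    let t := (β ⬝ᵥ l i0) / (α ⬝ᵥ l i0)
    refine ⟨t, ?_⟩
    by_contra hne
    let γ := β - t • α
    have hγ : γ ≠ 0 := sub_ne_zero.mpr hne
    have hγ0 : γ ⬝ᵥ l i0 = 0 := by
      simp only [γ, t, sub_dotProduct, smul_dotProduct, smul_eq_mul]
      rw [div_mul_cancel₀ _ (hl i0).2, sub_self]
    have hγG : dd γ G = 0 := by
      rw [← ddL_apply, map_sub, map_smul, ddL_apply, ddL_apply, hβ, hG0]
      simp
    have hγF : dd γ F = ∑ i, C ((γ ⬝ᵥ l i) / (α ⬝ᵥ l i)) * linForm (l i) ^ (d - 1) := by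
      rw [hddG] at hγG
      exact sub_eq_zero.mp hγG
    choose u hu0 hu using fun i : {i // γ ⬝ᵥ l i ≠ 0} => scale_pow hV (e := d - 1) (by omega)
      (div_ne_zero i.2 (hl i.1).2) (l i.1)
    refine hmin (Fintype.card {i // γ ⬝ᵥ l i ≠ 0})
      (Fintype.card_subtype_lt (x := i0) (by simpa using hγ0))
      ⟨γ, {i // γ ⬝ᵥ l i ≠ 0}, inferInstance, fun i => u i • l i.1, rfl, hγ,
        ⟨l i0, hγ0, (hl i0).1⟩, ?_, ?_⟩
    · intro i
      refine ⟨closed_smul hV (hl i.1).1 (hu0 i), ?_⟩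
      rw [dotProduct_smul]
      exact smul_ne_zero (hu0 i) i.2
    · simp only [← hu]
      rw [hγF]
      rw [← Finset.sum_filter_of_ne (s := Finset.univ) (p := fun i => γ ⬝ᵥ l i ≠ 0)]
      · exact Finset.sum_subtype _ (by simp) _
      · intro i _ h h0
        apply h
        rw [h0]
        simp
  obtain ⟨j, hj⟩ := Function.ne_iff.mp hα
  let G' := aeval (j.insertNth 0 X : Fin (N + 1) → MvPolynomial (Fin N) k) G
  have hGG' : G = aeval (fun i => linForm (redL α j (Pi.single i 1))) G' := reduce α j hj hG0
  have hG'h : G'.IsHomogeneous d := by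
    have := hGh.aeval (j.insertNth 0 X : Fin (N + 1) → MvPolynomial (Fin N) k) (n := 1) (by
      intro x
      refine Fin.succAboveCases j ?_ ?_ x
      · rw [Fin.insertNth_apply_same]; exact isHomogeneous_zero _ _ _
      · intro i; rw [Fin.insertNth_apply_succAbove]; exact isHomogeneous_X _ _)
    rw [one_mul] at this; exact this
  have hG'E : EssDep G' := by
    rw [essDep_iff]
    intro β' hβ'
    let β : Fin (N + 1) → k := j.insertNth 0 β'
    have hβG : dd β G = 0 := by
      rw [hGG', dd_chain β β', hβ', map_zero]
      intro i
      rw [dd_linForm]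
      congr 1
      rw [dotProduct, Fin.sum_univ_succAbove _ j]
      simp [β, redL, Pi.single_apply]
    obtain ⟨t, ht⟩ := hker β hβG
    have h0 := congrFun ht j
    simp only [β, Fin.insertNth_apply_same, Pi.smul_apply, smul_eq_mul] at h0
    have ht0 : t = 0 := by
      rcases mul_eq_zero.mp h0.symm with h | h
      · exact h
      · exact absurd h hj
    funext i
    have := congrFun ht (j.succAbove i)
    simpa [β, ht0] using this
  have hGb : OrkV d G V ≤ OrkND k N d := by
    rw [hGG']
    exact OrkV_transport (redL α j) hG'h hG'E hV (fun i => a' (j.succAbove i))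
      (by rw [redL_surj α j hj a' ha0]; exact haV)
  refine le_trans ?_ (add_le_add hGb hle)
  by_cases ht : OrkV d G V = ⊤
  · rw [ht]; simp
  obtain ⟨r, g, hr, hg, hgs⟩ := OrkV_exists ht
  rw [← hr]
  choose u hu0 hu using fun i => scale_pow hV (e := d) (by omega) (hc i) (l i)
  have := OrkV_le (ι := Fin r ⊕ ι) d F V (Sum.elim g (fun i => u i • l i)) (by
    rintro (i | i)
    · exact hg i
    · exact closed_smul hV (hl i).1 (hu0 i)) (by
    rw [Fintype.sum_sum_type]
    simp only [Sum.elim_inl, Sum.elim_inr, ← hu, ← hgs, G]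
    ring)
  simpa using this

end Helpers4

/-- For all integers `n ≥ 3` and `d ≥ 3`, the open Waring rank satisfies
`Ork(n, d) ≤ Ork(n-1, d) + Ork(n, d-1)`. -/
theorem stmt_0 (k : Type) [Field k] [IsAlgClosed k] [CharZero k]
    (n d : ℕ) (hn : 3 ≤ n) (hd : 3 ≤ d) :
    OrkND k n d ≤ OrkND k (n - 1) d + OrkND k n (d - 1) := by
  obtain ⟨N, rfl⟩ : ∃ N, n = N + 1 := ⟨n - 1, by omega⟩
  rw [Nat.add_sub_cancel]
  have key : ∀ (F : MvPolynomial (Fin (N + 1)) k), F.IsHomogeneous d → EssDep F →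
      ∀ V : Set (Fin (N + 1) → k), HomZariskiClosed V → V ≠ Set.univ →
      OrkV d F V ≤ OrkND k N d + OrkND k (N + 1) (d - 1) := by
    intro F hF hE V hV hne
    obtain ⟨a, ha⟩ := (Set.ne_univ_iff_exists_notMem V).mp hne
    exact main_bound hd (by omega) hF hE hV ha
  refine iSup_le ?_
  rintro ⟨F, hF, hE⟩
  refine iSup_le ?_
  rintro ⟨V, hV, hne⟩
  exact key F hF hE V hV hne
end

section
/- For every integer d ≥ 2, the open Waring rank in two variables satisfies Ork(2, d) = d. -/
open MvPolynomial

section Aux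

variable {k : Type} [Field k]

theorem aux_shift (c : ℕ → k) (n : ℕ) (p : Polynomial k) (hp : p.natDegree ≤ n) (s : k) :
    ∑ j ∈ Finset.range (n + 2), ((Polynomial.X - Polynomial.C s) * p).coeff j * c j =
      ∑ j ∈ Finset.range (n + 1), p.coeff j * (c (j + 1) - s * c j) := by
  have h1 : ∑ j ∈ Finset.range (n + 2), (Polynomial.X * p).coeff j * c j =
      ∑ j ∈ Finset.range (n + 1), p.coeff j * c (j + 1) := by
    rw [Finset.sum_range_succ']
    simp
  have h2 : ∑ j ∈ Finset.range (n + 2), (Polynomial.C s * p).coeff j * c j =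
      ∑ j ∈ Finset.range (n + 1), s * p.coeff j * c j := by
    rw [Finset.sum_range_succ, Polynomial.coeff_C_mul,
      Polynomial.coeff_eq_zero_of_natDegree_lt (show p.natDegree < n + 1 by omega)]
    simp
  simp only [sub_mul, Polynomial.coeff_sub, Finset.sum_sub_distrib]
  rw [h1, h2, ← Finset.sum_sub_distrib]
  refine Finset.sum_congr rfl fun j _ => by ring

theorem aux_pow [CharZero k] (c : ℕ → k) (n : ℕ) (hc : ∃ j ≤ n, c j ≠ 0) :
    ∃ s : k, ∑ j ∈ Finset.range (n + 1),
      ((Polynomial.X - Polynomial.C s) ^ n).coeff j * c j ≠ 0 := by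
  by_contra! H
  obtain ⟨j, hj, hcj⟩ := hc
  set P : Polynomial k := ∑ j ∈ Finset.range (n + 1),
    Polynomial.C (n.choose j * c j) * Polynomial.X ^ (n - j) with hP
  have hP0 : P = 0 := by
    apply Polynomial.funext
    intro r
    have := H (-r)
    rw [hP, Polynomial.eval_finsetSum, Polynomial.eval_zero, ← this]
    refine Finset.sum_congr rfl fun i _ => ?_
    rw [Polynomial.C_neg, sub_neg_eq_add, Polynomial.coeff_X_add_C_pow]
    simp
    ring
  have h2 : P.coeff (n - j) = n.choose j * c j := by
    rw [hP, Polynomial.finsetSum_coeff, Finset.sum_eq_single j]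
    · rw [Polynomial.coeff_C_mul_X_pow, if_pos rfl]
    · intro i hi hij
      have := Finset.mem_range.1 hi
      rw [Polynomial.coeff_C_mul_X_pow, if_neg (by omega)]
    · intro h
      exact absurd (Finset.mem_range.2 (by omega)) h
  rw [hP0, Polynomial.coeff_zero] at h2
  have : (n.choose j : k) ≠ 0 := by exact_mod_cast (Nat.choose_pos hj).ne'
  exact mul_ne_zero this hcj h2.symm

/-- Coefficients of the generic monic polynomial with roots the variables. -/
noncomputable def genCoeff (k : Type) [Field k] (n j : ℕ) : MvPolynomial (Fin n) k :=
  (∏ i : Fin n, (Polynomial.X - Polynomial.C (X i : MvPolynomial (Fin n) k))).coeff j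

theorem eval_genCoeff (n j : ℕ) (t : Fin n → k) :
    eval t (genCoeff k n j) =
      (∏ i : Fin n, (Polynomial.X - Polynomial.C (t i))).coeff j := by
  rw [genCoeff, ← Polynomial.coeff_map, Polynomial.map_prod]
  simp

theorem eval_genCoeff_const (n j : ℕ) (s : k) :
    eval (fun _ => s) (genCoeff k n j) =
      ((Polynomial.X - Polynomial.C s) ^ n).coeff j := by
  rw [eval_genCoeff]
  simp

theorem aux_key [CharZero k] (c : ℕ → k) (n : ℕ) (B : Finset k)
    (h1 : ∃ j ≤ n, c j ≠ 0) (h2 : ∀ b : k, ∃ j ≤ n, c (j + 1) - b * c j ≠ 0) :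
    ∃ t : Fin (n + 1) → k, Function.Injective t ∧ (∀ i, t i ∉ B) ∧
      ∑ j ∈ Finset.range (n + 2),
        (∏ i, (Polynomial.X - Polynomial.C (t i))).coeff j * c j = 0 := by
  classical
  let β : MvPolynomial (Fin n) k := ∑ j ∈ Finset.range (n + 1), genCoeff k n j * C (c j)
  let α : MvPolynomial (Fin n) k := ∑ j ∈ Finset.range (n + 1), genCoeff k n j * C (c (j + 1))
  have hne : ∀ (p : MvPolynomial (Fin n) k) (x : Fin n → k), eval x p ≠ 0 → p ≠ 0 := by
    rintro p x h rfl
    simp at h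
  have hβ : β ≠ 0 := by
    obtain ⟨s, hs⟩ := aux_pow c n h1
    refine hne _ (fun _ => s) ?_
    simpa only [β, map_sum, map_mul, eval_C, eval_genCoeff_const] using hs
  have hα : ∀ b : k, α - C b * β ≠ 0 := by
    intro b
    obtain ⟨s, hs⟩ := aux_pow (fun j => c (j + 1) - b * c j) n (h2 b)
    refine hne _ (fun _ => s) ?_
    simp only [α, β, map_sub, map_sum, map_mul, eval_C, eval_genCoeff_const]
    rw [Finset.mul_sum, ← Finset.sum_sub_distrib]
    convert hs using 1
    refine Finset.sum_congr rfl fun j _ => by ring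
  have hαi : ∀ i : Fin n, α - X i * β ≠ 0 := by
    intro i
    obtain ⟨s, hs⟩ := aux_pow c (n + 1) (by
      obtain ⟨j, hj, h⟩ := h1
      exact ⟨j, by omega, h⟩)
    refine hne _ (fun _ => s) ?_
    simp only [α, β, map_sub, map_sum, map_mul, eval_C, eval_X, eval_genCoeff_const]
    rw [Finset.mul_sum, ← Finset.sum_sub_distrib]
    rw [pow_succ', aux_shift c n _ (by
      rw [Polynomial.natDegree_pow, Polynomial.natDegree_X_sub_C, mul_one])] at hs
    convert hs using 1
    refine Finset.sum_congr rfl fun j _ => by ring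
  have hX : ∀ i j : Fin n, i ≠ j → (X i - X j : MvPolynomial (Fin n) k) ≠ 0 := by
    intro i j hij
    refine hne _ (Pi.single i 1) ?_
    simp [Pi.single_apply, hij.symm]
  have hXb : ∀ (i : Fin n) (b : k), (X i - C b : MvPolynomial (Fin n) k) ≠ 0 := by
    intro i b
    refine hne _ (fun _ => b + 1) ?_
    simp
  let Q : MvPolynomial (Fin n) k := β * (∏ b ∈ B, (α - C b * β)) * (∏ i, (α - X i * β)) *
    (∏ p ∈ (Finset.univ : Finset (Fin n)).offDiag, (X p.1 - X p.2)) *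
    (∏ i, ∏ b ∈ B, (X i - C b))
  have hQ : Q ≠ 0 := by
    refine mul_ne_zero (mul_ne_zero (mul_ne_zero (mul_ne_zero hβ ?_) ?_) ?_) ?_
    · exact Finset.prod_ne_zero_iff.2 fun b _ => hα b
    · exact Finset.prod_ne_zero_iff.2 fun i _ => hαi i
    · exact Finset.prod_ne_zero_iff.2 fun p hp => hX _ _ (Finset.mem_offDiag.1 hp).2.2
    · exact Finset.prod_ne_zero_iff.2 fun i _ => Finset.prod_ne_zero_iff.2 fun b _ => hXb i b
  obtain ⟨t, ht⟩ : ∃ t, eval t Q ≠ 0 := by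
    by_contra! H
    exact hQ (MvPolynomial.funext fun x => by simpa using H x)
  simp only [Q, map_mul, map_prod, mul_ne_zero_iff, Finset.prod_ne_zero_iff, map_sub, eval_X,
    eval_C, Finset.mem_univ, true_imp_iff] at ht
  obtain ⟨⟨⟨⟨g1, g2⟩, g3⟩, g4⟩, g5⟩ := ht
  set τ : k := eval t α / eval t β with hτ
  have hτβ : eval t α = τ * eval t β := by rw [hτ]; field_simp
  refine ⟨Fin.cons τ t, ?_, ?_, ?_⟩
  · rw [Fin.cons_injective_iff]
    constructor
    · rintro ⟨i, hi⟩
      apply g3 i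
      rw [hi, hτβ, sub_self]
    · intro i j hij
      by_contra hne
      exact g4 (i, j) (by simp [hne]) (by simp [hij])
  · intro i
    refine Fin.cases ?_ (fun i => ?_) i
    · intro h
      simp only [Fin.cons_zero] at h
      apply g2 τ h
      rw [hτβ, sub_self]
    · intro h
      simp only [Fin.cons_succ] at h
      exact g5 i _ h (sub_self _)
  · rw [Fin.prod_univ_succ]
    simp only [Fin.cons_zero, Fin.cons_succ]
    rw [aux_shift c n]
    · have e1 : eval t α = ∑ j ∈ Finset.range (n + 1),
          (∏ i : Fin n, (Polynomial.X - Polynomial.C (t i))).coeff j * c (j + 1) := by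
        simp only [α, map_sum, map_mul, eval_C, eval_genCoeff]
      have e2 : eval t β = ∑ j ∈ Finset.range (n + 1),
          (∏ i : Fin n, (Polynomial.X - Polynomial.C (t i))).coeff j * c j := by
        simp only [β, map_sum, map_mul, eval_C, eval_genCoeff]
      rw [← sub_eq_zero, e1, e2, Finset.mul_sum, ← Finset.sum_sub_distrib] at hτβ
      rw [← hτβ]
      refine Finset.sum_congr rfl fun j _ => by ring
    · rw [Polynomial.natDegree_prod_of_monic _ _ fun i _ => Polynomial.monic_X_sub_C _]
      simp

theorem aux_weights (c : ℕ → k) (d : ℕ) (t : Fin d → k) (ht : Function.Injective t)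
    (h : ∑ j ∈ Finset.range (d + 1),
        (∏ i, (Polynomial.X - Polynomial.C (t i))).coeff j * c j = 0) :
    ∃ w : Fin d → k, ∀ j ≤ d, c j = ∑ i, w i * t i ^ j := by
  classical
  let φ : Polynomial k →ₗ[k] k :=
    ∑ j ∈ Finset.range (d + 1), c j • Polynomial.lcoeff k j
  have hφ : ∀ p, φ p = ∑ j ∈ Finset.range (d + 1), p.coeff j * c j := by
    intro p
    simp only [φ, LinearMap.sum_apply, LinearMap.smul_apply, Polynomial.lcoeff_apply, smul_eq_mul]
    refine Finset.sum_congr rfl fun j _ => mul_comm _ _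
  have hφX : ∀ j ≤ d, φ (Polynomial.X ^ j) = c j := by
    intro j hj
    rw [hφ, Finset.sum_eq_single j]
    · simp
    · intro i _ hij
      simp [Polynomial.coeff_X_pow, hij]
    · intro h
      exact absurd (Finset.mem_range.2 (by omega)) h
  have hlow : ∀ p : Polynomial k, p.degree < d →
      φ p = ∑ i, φ (Lagrange.basis Finset.univ t i) * p.eval (t i) := by
    intro p hp
    have := Lagrange.eq_interpolate (s := Finset.univ) (v := t) (f := p) ht.injOn (by simpa using hp)
    conv_lhs => rw [this]
    rw [Lagrange.interpolate_apply, map_sum]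
    refine Finset.sum_congr rfl fun i _ => ?_
    rw [← Polynomial.smul_eq_C_mul, map_smul, smul_eq_mul, mul_comm]
  refine ⟨fun i => φ (Lagrange.basis Finset.univ t i), fun j hj => ?_⟩
  rw [← hφX j hj]
  rcases hj.lt_or_eq with hj | rfl
  · rw [hlow _ (by rw [Polynomial.degree_X_pow]; exact_mod_cast hj)]
    simp
  · have hg : φ (Lagrange.nodal Finset.univ t) = 0 := by
      rw [hφ, Lagrange.nodal_eq, h]
    have : φ (Polynomial.X ^ j) = φ (Polynomial.X ^ j - Lagrange.nodal Finset.univ t) := by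
      rw [map_sub, hg, sub_zero]
    rw [this, hlow]
    · refine Finset.sum_congr rfl fun i _ => ?_
      rw [Polynomial.eval_sub, Lagrange.eval_nodal_at_node (Finset.mem_univ i)]
      simp
    · have hd : (Polynomial.X ^ j : Polynomial k).degree = j := Polynomial.degree_X_pow j
      rw [← hd]
      refine Polynomial.degree_sub_lt_left ?_ ?_ ?_
      · rw [Lagrange.degree_nodal, hd]; simp
      · exact pow_ne_zero _ Polynomial.X_ne_zero
      · rw [(Polynomial.monic_X_pow j).leadingCoeff, Lagrange.nodal_monic.leadingCoeff]

theorem aux_expand (F : MvPolynomial (Fin 2) k) (d : ℕ) (hF : F.IsHomogeneous d) :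
    ∃ f : ℕ → k, F = ∑ j ∈ Finset.range (d + 1), C (f j) * (X 0 ^ (d - j) * X 1 ^ j) := by
  classical
  refine ⟨fun j => coeff (Finsupp.single 0 (d - j) + Finsupp.single 1 j) F, ?_⟩
  ext m
  have hmon : ∀ j, coeff m (C (coeff (Finsupp.single 0 (d - j) + Finsupp.single 1 j) F) *
      (X 0 ^ (d - j) * X 1 ^ j) : MvPolynomial (Fin 2) k) =
      if (Finsupp.single 0 (d - j) + Finsupp.single 1 j : Fin 2 →₀ ℕ) = m then coeff m F else 0 := by
    intro j
    rw [X_pow_eq_monomial, X_pow_eq_monomial, monomial_mul, C_mul_monomial, coeff_monomial]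
    split_ifs with h
    · rw [h]; simp
    · rfl
  rw [coeff_sum]
  simp only [hmon]
  by_cases hm : m.degree = d
  · have hm' : m 0 + m 1 = d := by
      rw [← hm, Finsupp.degree_eq_sum]; simp
    rw [Finset.sum_eq_single (m 1)]
    · rw [if_pos]
      ext i
      fin_cases i
      · simp; omega
      · simp
    · intro j _ hj
      rw [if_neg]
      rintro rfl
      simp at hj
    · intro h
      exact absurd (Finset.mem_range.2 (by omega)) h
  · rw [hF.coeff_eq_zero hm]
    simp

theorem linForm_two (a : Fin 2 → k) : linForm a = C (a 0) * X 0 + C (a 1) * X 1 := by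
  simp [linForm, Fin.sum_univ_two]

theorem linForm_pow (a : Fin 2 → k) (d : ℕ) :
    linForm a ^ d = ∑ j ∈ Finset.range (d + 1),
      C (d.choose j * (a 0 ^ (d - j) * a 1 ^ j)) * (X 0 ^ (d - j) * X 1 ^ j) := by
  rw [linForm_two, add_comm, add_pow]
  refine Finset.sum_congr rfl fun j _ => ?_
  simp only [map_mul, map_pow, map_natCast]
  ring

theorem linForm_homog {n : ℕ} (a : Fin n → k) : (linForm a).IsHomogeneous 1 :=
  IsHomogeneous.sum _ _ _ fun i _ => isHomogeneous_C_mul_X _ _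

theorem writable_pow (r : k) (a : Fin 2 → k) (d : ℕ) : WritableIn 1 (C r * linForm a ^ d) :=
  ⟨fun _ => linForm a, fun _ => linForm_homog a, C r * X 0 ^ d, by simp⟩

theorem eval_homog {n e : ℕ} (p : MvPolynomial (Fin n) k) (hp : p.IsHomogeneous e) (r : k)
    (a : Fin n → k) : eval (fun i => r * a i) p = r ^ e * eval a p := by
  rw [eval_eq, eval_eq, Finset.mul_sum]
  refine Finset.sum_congr rfl fun m hm => ?_
  have : ∑ i, m i = e := by
    rw [← Finsupp.degree_eq_sum]
    by_contra h
    exact (mem_support_iff.1 hm) (hp.coeff_eq_zero h)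
  have h2 : ∀ f : Fin n → k, ∏ i ∈ m.support, f i ^ m i = ∏ i, f i ^ m i := by
    intro f
    refine Finset.prod_subset (Finset.subset_univ _) fun i _ hi => ?_
    rw [Finsupp.notMem_support_iff.1 hi, pow_zero]
  rw [h2, h2]
  simp only [mul_pow, Finset.prod_mul_distrib, Finset.prod_pow_eq_pow_sum, this]
  ring

theorem aux_bad [CharZero k] (V : Set (Fin 2 → k)) (hV : HomZariskiClosed V) (hne : V ≠ Set.univ) :
    ∃ B : Finset k, ∀ t ∉ B, ∀ r : k, r ≠ 0 → (![r, r * t] : Fin 2 → k) ∉ V := by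
  classical
  obtain ⟨P, hP, rfl⟩ := hV
  obtain ⟨a, ha⟩ := (Set.ne_univ_iff_exists_notMem _).1 hne
  simp only [Set.mem_setOf_eq, not_forall] at ha
  obtain ⟨p, hp, hpa⟩ := ha
  obtain ⟨e, he⟩ := hP p hp
  let q : Polynomial k := aeval ![1, Polynomial.X] p
  have hq : ∀ t, q.eval t = eval ![1, t] p := by
    intro t
    have : (Polynomial.aeval t) (aeval ![1, Polynomial.X] p : Polynomial k) = aeval ![1, t] p := by
      rw [← AlgHom.comp_apply, comp_aeval]
      congr 2
      ext i
      fin_cases i <;> simp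
    simpa [aeval_eq_eval, Polynomial.coe_aeval_eq_eval] using this
  have hev : ∀ r t, eval (![r, r * t] : Fin 2 → k) p = r ^ e * q.eval t := by
    intro r t
    rw [hq, ← eval_homog p he]
    congr 2
    ext i
    fin_cases i <;> simp
  have hq0 : q ≠ 0 := by
    intro h0
    have : X 0 * p = 0 := by
      apply MvPolynomial.funext
      intro x
      by_cases hx : x 0 = 0
      · simp [hx]
      · have h3 := hev (x 0) (x 1 / x 0)
        have h4 : (![x 0, x 0 * (x 1 / x 0)] : Fin 2 → k) = x := by
          ext i
          fin_cases i
          · simp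
          · simp; field_simp
        rw [h4, h0] at h3
        simp [h3]
    rcases mul_eq_zero.1 this with h | h
    · exact X_ne_zero 0 h
    · simp [h] at hpa
  refine ⟨q.roots.toFinset, fun t ht r hr hmem => ?_⟩
  have := hmem p hp
  rw [hev] at this
  rcases mul_eq_zero.1 this with h | h
  · exact pow_ne_zero _ hr h
  · exact ht (by simp [hq0, h])

theorem upper [IsAlgClosed k] [CharZero k] (d : ℕ) (hd : 2 ≤ d) (F : MvPolynomial (Fin 2) k)
    (hF : F.IsHomogeneous d) (hess : EssDep F) (V : Set (Fin 2 → k)) (hV : HomZariskiClosed V)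
    (hne : V ≠ Set.univ) : OrkV d F V ≤ d := by
  classical
  obtain ⟨B, hB⟩ := aux_bad V hV hne
  obtain ⟨f, hf⟩ := aux_expand F d hF
  obtain ⟨n, rfl⟩ : ∃ n, d = n + 1 := ⟨d - 1, by omega⟩
  let c : ℕ → k := fun j => f j / ((n + 1).choose j : k)
  have hfc : ∀ j ≤ n + 1, f j = (n + 1).choose j * c j := by
    intro j hj
    have : ((n + 1).choose j : k) ≠ 0 := by exact_mod_cast (Nat.choose_pos hj).ne'
    simp only [c]
    field_simp
  have hw := hess 1 (by norm_num)
  have h1 : ∃ j ≤ n, c j ≠ 0 := by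
    by_contra! H
    apply hw
    convert writable_pow (f (n + 1)) ![0, 1] (n + 1) using 1
    rw [hf, Finset.sum_range_succ, Finset.sum_eq_zero]
    · simp [linForm_two]
    · intro j hj
      have := Finset.mem_range.1 hj
      rw [hfc j (by omega), H j (by omega)]
      simp
  have h2 : ∀ b : k, ∃ j ≤ n, c (j + 1) - b * c j ≠ 0 := by
    intro b
    by_contra! H
    apply hw
    have hc : ∀ j ≤ n + 1, c j = c 0 * b ^ j := by
      intro j
      induction j with
      | zero => simp
      | succ j ih =>
        intro hj
        rw [sub_eq_zero.1 (H j (by omega)), ih (by omega)]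
        ring
    convert writable_pow (c 0) ![1, b] (n + 1) using 1
    rw [hf, linForm_pow, Finset.mul_sum]
    refine Finset.sum_congr rfl fun j hj => ?_
    have := Finset.mem_range.1 hj
    rw [hfc j (by omega), hc j (by omega), ← mul_assoc (C (c 0)), ← C_mul]
    congr 2
    simp
    ring
  obtain ⟨t, htinj, htB, ht⟩ := aux_key c n B h1 h2
  obtain ⟨w, hw⟩ := aux_weights c (n + 1) t htinj ht
  have hr : ∀ i, ∃ r : k, r ^ (n + 1) = w i := fun i =>
    IsAlgClosed.exists_pow_nat_eq (w i) (Nat.succ_pos n)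
  choose r hr using hr
  have hsum : F = ∑ i, linForm (![r i, r i * t i] : Fin 2 → k) ^ (n + 1) := by
    simp only [linForm_pow]
    rw [hf, Finset.sum_comm]
    refine Finset.sum_congr rfl fun j hj => ?_
    have hj' : j ≤ n + 1 := by have := Finset.mem_range.1 hj; omega
    rw [← Finset.sum_mul, ← map_sum, hfc j hj', hw j hj', Finset.mul_sum]
    congr 2
    refine Finset.sum_congr rfl fun i _ => ?_
    simp only [Matrix.cons_val_zero, Matrix.cons_val_one]
    rw [mul_pow, ← mul_assoc (r i ^ _), ← pow_add, Nat.sub_add_cancel hj', hr]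
  let s : Finset (Fin (n + 1)) := Finset.univ.filter fun i => r i ≠ 0
  have hs : s.card ≤ n + 1 := (Finset.card_le_univ s).trans (by simp)
  have : OrkV (n + 1) F V ≤ (s.card : ℕ∞) := by
    apply sInf_le
    refine ⟨s.card, ⟨fun j => ![r (s.equivFin.symm j), r (s.equivFin.symm j) * t (s.equivFin.symm j)],
      ?_, ?_⟩, rfl⟩
    · intro j
      refine hB _ (htB _) _ ?_
      exact (Finset.mem_filter.1 (s.equivFin.symm j).2).2
    · rw [hsum]
      rw [Equiv.sum_comp s.equivFin.symm
        (fun i : s => linForm (![r i, r i * t i] : Fin 2 → k) ^ (n + 1))]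
      rw [Finset.sum_coe_sort s (fun i => linForm (![r i, r i * t i] : Fin 2 → k) ^ (n + 1))]
      symm
      refine Finset.sum_subset (Finset.subset_univ _) fun i _ hi => ?_
      have : r i = 0 := by simpa [s] using hi
      simp [this, linForm_two]
  exact this.trans (by exact_mod_cast hs)

theorem homog_one_eq {n : ℕ} (y : MvPolynomial (Fin n) k) (hy : y.IsHomogeneous 1) :
    ∃ a : Fin n → k, y = linForm a := by
  have : y ∈ homogeneousSubmodule (Fin n) k 1 := hy
  rw [homogeneousSubmodule_one_eq_span_X, Submodule.mem_span_range_iff_exists_fun] at this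
  obtain ⟨a, ha⟩ := this
  exact ⟨a, by rw [← ha, linForm]; simp [smul_eq_C_mul]⟩

theorem lower_ess (d : ℕ) (hd : 2 ≤ d) :
    EssDep (X 0 ^ (d - 1) * X 1 : MvPolynomial (Fin 2) k) := by
  rintro m hm ⟨y, hy, G, hG⟩
  have hdir : ∃ v : Fin 2 → k, v ≠ 0 ∧ ∀ j s, eval (fun i => 1 + s * v i) (y j) =
      eval (fun _ => 1) (y j) := by
    interval_cases m
    · exact ⟨fun _ => 1, fun h => by simpa using congrFun h 0, fun j => j.elim0⟩
    · obtain ⟨a, ha⟩ := homog_one_eq (y 0) (hy 0)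
      have key : ∀ v : Fin 2 → k, a 0 * v 0 + a 1 * v 1 = 0 → ∀ (j : Fin 1) (s : k),
          eval (fun i => 1 + s * v i) (y j) = eval (fun _ => 1) (y j) := by
        intro v hv j s
        rw [Subsingleton.elim j 0, ha, linForm_two]
        simp
        linear_combination s * hv
      by_cases h : a = 0
      · exact ⟨fun _ => 1, fun h => by simpa using congrFun h 0, key _ (by simp [h])⟩
      · refine ⟨![-a 1, a 0], fun h0 => h ?_, key _ (by simp; ring)⟩
        have e0 := congrFun h0 0
        have e1 := congrFun h0 1
        simp at e0 e1
        ext i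
        fin_cases i
        · simpa using e1
        · simpa using e0
  obtain ⟨v, hv, hvy⟩ := hdir
  have hev : ∀ x : Fin 2 → k, x 0 ^ (d - 1) * x 1 = aeval (fun j => eval x (y j)) G := by
    intro x
    have h := congrArg (aeval x) hG
    rw [← AlgHom.comp_apply, comp_aeval] at h
    simpa [aeval_eq_eval] using h
  have hs : ∀ s : k, (1 + s * v 0) ^ (d - 1) * (1 + s * v 1) = 1 := by
    intro s
    have h1 := hev (fun i => 1 + s * v i)
    have h2 := hev (fun _ => 1)
    simp only [hvy] at h1
    rw [← h2] at h1
    simpa using h1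
  by_cases h0 : v 0 = 0
  · by_cases h1 : v 1 = 0
    · apply hv
      ext i
      fin_cases i
      · exact h0
      · exact h1
    · have := hs (-(v 1)⁻¹)
      simp [h1] at this
  · have := hs (-(v 0)⁻¹)
    have hd1 : d - 1 ≠ 0 := by omega
    simp [h0, hd1] at this

theorem lower_rank [CharZero k] (d m : ℕ) (hd : 2 ≤ d) (l : Fin m → Fin 2 → k)
    (hl : ∀ i, l i 0 * l i 1 ≠ 0)
    (h : (X 0 ^ (d - 1) * X 1 : MvPolynomial (Fin 2) k) = ∑ i, linForm (l i) ^ d) : d ≤ m := by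
  by_contra! hm
  have hl0 : ∀ i, l i 0 ≠ 0 := fun i => left_ne_zero_of_mul (hl i)
  have hl1 : ∀ i, l i 1 ≠ 0 := fun i => right_ne_zero_of_mul (hl i)
  have h1 := congrArg (aeval (![1, Polynomial.X] : Fin 2 → Polynomial k)) h
  simp only [linForm_pow, map_sum, map_mul, map_pow, aeval_X, aeval_C, Matrix.cons_val_zero,
    Matrix.cons_val_one, one_pow, one_mul, Polynomial.algebraMap_eq] at h1
  have hc : ∀ j ≤ d, (if j = 1 then 1 else 0 : k) =
      d.choose j * ∑ i, l i 0 ^ d * (l i 1 / l i 0) ^ j := by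
    intro j hj
    have h2 := congrArg (fun p => Polynomial.coeff p j) h1
    simp only [Polynomial.coeff_X, Polynomial.finsetSum_coeff, ← Polynomial.C_mul,
      ← Polynomial.C_pow, ← map_natCast (Polynomial.C : k →+* _),
      Polynomial.coeff_C_mul, Polynomial.coeff_X_pow] at h2
    simp only [eq_comm (a := j) (b := 1)]
    rw [h2, Finset.mul_sum]
    refine Finset.sum_congr rfl fun i _ => ?_
    rw [Finset.sum_eq_single j]
    · simp only [if_true, mul_one]
      congr 1
      have := hl0 i
      rw [div_pow, ← Nat.sub_add_cancel hj, pow_add, Nat.add_sub_cancel]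
      field_simp
    · intro i _ hij
      simp [hij.symm]
    · intro h
      exact absurd (Finset.mem_range.2 (by omega)) h
  let g : Polynomial k := ∏ i, (Polynomial.X - Polynomial.C (l i 1 / l i 0))
  have hg : g.natDegree = m := by
    simp only [g]
    rw [Polynomial.natDegree_prod_of_monic _ _ fun i _ => Polynomial.monic_X_sub_C _]
    simp
  have hg0 : g.coeff 0 ≠ 0 := by
    rw [Polynomial.coeff_zero_eq_eval_zero]
    simp only [g, Polynomial.eval_prod]
    refine Finset.prod_ne_zero_iff.2 fun i _ => ?_
    simp [hl0 i, hl1 i]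
  have hdeg : (Polynomial.X * g).natDegree < d + 1 := by
    have := Polynomial.natDegree_mul_le (p := (Polynomial.X : Polynomial k)) (q := g)
    rw [Polynomial.natDegree_X, hg] at this
    omega
  have hz : ∑ j ∈ Finset.range (d + 1), (Polynomial.X * g).coeff j *
      (∑ i, l i 0 ^ d * (l i 1 / l i 0) ^ j) = 0 := by
    simp only [Finset.mul_sum]
    rw [Finset.sum_comm]
    refine Finset.sum_eq_zero fun i _ => ?_
    have : (Polynomial.X * g).eval (l i 1 / l i 0) = 0 := by
      rw [Polynomial.eval_mul]
      simp only [g, Polynomial.eval_prod]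
      rw [Finset.prod_eq_zero (Finset.mem_univ i) (by simp), mul_zero]
    rw [Polynomial.eval_eq_sum_range' hdeg] at this
    calc _ = l i 0 ^ d * ∑ j ∈ Finset.range (d + 1),
          (Polynomial.X * g).coeff j * (l i 1 / l i 0) ^ j := by
          rw [Finset.mul_sum]
          refine Finset.sum_congr rfl fun j _ => by ring
      _ = 0 := by rw [this, mul_zero]
  rw [Finset.sum_eq_single 1] at hz
  · have h3 := hc 1 (by omega)
    rcases mul_eq_zero.1 hz with h4 | h4
    · rw [show (1 : ℕ) = 0 + 1 from rfl, Polynomial.coeff_X_mul] at h4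
      exact hg0 h4
    · rw [h4] at h3
      simp at h3
  · intro j hj hj1
    have hj' : j ≤ d := by have := Finset.mem_range.1 hj; omega
    have h3 := hc j hj'
    rw [if_neg hj1] at h3
    have : (d.choose j : k) ≠ 0 := by exact_mod_cast (Nat.choose_pos hj').ne'
    rcases mul_eq_zero.1 h3.symm with h4 | h4
    · exact absurd h4 this
    · rw [h4, mul_zero]
  · intro h
    exact absurd (Finset.mem_range.2 (by omega)) h

end Aux

/-- For every integer `d ≥ 2`, the open Waring rank in two variables satisfies
`Ork(2, d) = d`. -/
theorem stmt_1 (k : Type) [Field k] [IsAlgClosed k] [CharZero k]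
    (d : ℕ) (hd : 2 ≤ d) :
    OrkND k 2 d = (d : ℕ∞) := by
  apply le_antisymm
  · exact iSup_le fun F => iSup_le fun V => upper d hd F.1 F.2.1 F.2.2 V.1 V.2.1 V.2.2
  · have hF : (X 0 ^ (d - 1) * X 1 : MvPolynomial (Fin 2) k).IsHomogeneous d := by
      have := (isHomogeneous_X_pow (R := k) (0 : Fin 2) (d - 1)).mul (isHomogeneous_X k (1 : Fin 2))
      rwa [Nat.sub_add_cancel (by omega)] at this
    let V : Set (Fin 2 → k) := {a | a 0 * a 1 = 0}
    have hV : HomZariskiClosed V := by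
      refine ⟨{X 0 * X 1}, ?_, ?_⟩
      · rintro p rfl
        exact ⟨1 + 1, (isHomogeneous_X k (0 : Fin 2)).mul (isHomogeneous_X k (1 : Fin 2))⟩
      · ext a
        simp [V]
    have hne : V ≠ Set.univ := by
      intro h
      have : (fun _ => 1 : Fin 2 → k) ∈ V := h ▸ Set.mem_univ _
      simp [V] at this
    refine le_trans ?_ (le_iSup (fun F : {F : MvPolynomial (Fin 2) k // F.IsHomogeneous d ∧ EssDep F}
      => Ork d F.1) ⟨_, hF, lower_ess d hd⟩)
    refine le_trans ?_ (le_iSup (fun W : {V : Set (Fin 2 → k) // HomZariskiClosed V ∧ V ≠ Set.univ}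
      => OrkV d (X 0 ^ (d - 1) * X 1 : MvPolynomial (Fin 2) k) W.1) ⟨V, hV, hne⟩)
    apply le_sInf
    rintro _ ⟨m, ⟨l, hl, h⟩, rfl⟩
    exact Nat.cast_le.2 (lower_rank d m hd l hl h)
end
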